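/- arXiv:2503.17101 — 2 statements merged into one kernel-verified Lean document; each statement's English description precedes it below -/
import Mathlib

section
/- Let A ∈ ℝ^{m×n}, let X ∈ ℝ^{n×p} have full row rank n, let X Xᵀ = P Λ Pᵀ be a spectral decomposition with P orthogonal and Λ diagonal with positive diagonal entries, and let γ > 0. Let γ·(A P) = Σ_{i=1}^r σ̂_i û_i v̂_iᵀ be an SVD, where r = rank(A). Fix an index j with 1 ≤ j ≤ r and define Ã = (1/γ)·(Σ_{i≠j, 1≤i≤r} σ̂_i û_i v̂_iᵀ)·Pᵀ, i.e., the matrix obtained by truncating the j-th singular term of γ·A P and undoing the rotation and scaling. Then the compression loss satisfies ‖(A − Ã) X‖_F = (σ̂_j/γ)·√(v̂_jᵀ Λ v̂_j). -/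
open Matrix Finset

/-- Frobenius norm of a real matrix. -/
noncomputable def frob {m n : ℕ} (M : Matrix (Fin m) (Fin n) ℝ) : ℝ :=
  Real.sqrt (∑ i, ∑ j, (M i j) ^ 2)

/-- The Frobenius norm of `c • a bᵀ` is `c ‖b‖` when `a` is a unit vector and `c ≥ 0`. -/
theorem frob_smul_vecMulVec {m n : ℕ} (c : ℝ) (hc : 0 ≤ c) (a : Fin m → ℝ) (b : Fin n → ℝ)
    (ha : a ⬝ᵥ a = 1) : frob (c • vecMulVec a b) = c * Real.sqrt (b ⬝ᵥ b) := by
  have h : ∑ i, ∑ j, ((c • vecMulVec a b) i j) ^ 2 = c ^ 2 * (b ⬝ᵥ b) := by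
    calc _ = c ^ 2 * ((a ⬝ᵥ a) * (b ⬝ᵥ b)) := by
          simp only [dotProduct]
          rw [Finset.sum_mul_sum]
          simp only [Finset.mul_sum, Matrix.smul_apply, vecMulVec_apply, smul_eq_mul]
          exact Finset.sum_congr rfl fun i _ => Finset.sum_congr rfl fun j _ => by ring
      _ = _ := by rw [ha, one_mul]
  rw [frob, h, Real.sqrt_mul (sq_nonneg c), Real.sqrt_sq hc]

/-- If `X Xᵀ = P D Pᵀ` with `P` orthogonal, then `‖(P v)ᵀ X‖² = vᵀ D v`. -/
theorem dotProduct_vecMul_of_spectral {n p : ℕ} {X : Matrix (Fin n) (Fin p) ℝ}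
    {P D : Matrix (Fin n) (Fin n) ℝ} (hP : Pᵀ * P = 1) (hspec : X * Xᵀ = P * D * Pᵀ)
    (v : Fin n → ℝ) :
    (v ᵥ* (Pᵀ * X)) ⬝ᵥ (v ᵥ* (Pᵀ * X)) = v ⬝ᵥ (D *ᵥ v) := by
  have h : (Pᵀ * X) * (Pᵀ * X)ᵀ = D := by
    calc (Pᵀ * X) * (Pᵀ * X)ᵀ = Pᵀ * (X * Xᵀ) * P := by
          simp only [transpose_mul, transpose_transpose, Matrix.mul_assoc]
      _ = (Pᵀ * P) * D * (Pᵀ * P) := by simp only [hspec, Matrix.mul_assoc]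
      _ = D := by rw [hP, Matrix.one_mul, Matrix.mul_one]
  rw [← dotProduct_mulVec, ← mulVec_transpose, mulVec_mulVec, h]

/-- ASVD-III, single truncation: with `X Xᵀ = P Λ Pᵀ` and an SVD of `γ·(A P)`, truncating the
`j`-th singular term yields compression loss `(σ̂_j/γ)·√(v̂_jᵀ Λ v̂_j)`. -/
theorem asvd_scaled_eigen_single_truncation_loss
    (m n p r : ℕ) (A : Matrix (Fin m) (Fin n) ℝ)
    (X : Matrix (Fin n) (Fin p) ℝ) (hX : X.rank = n)
    (P : Matrix (Fin n) (Fin n) ℝ) (d : Fin n → ℝ)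
    (hP : Pᵀ * P = 1) (hd : ∀ i, 0 < d i)
    (hspec : X * Xᵀ = P * Matrix.diagonal d * Pᵀ)
    (γ : ℝ) (hγ : 0 < γ)
    (σ : Fin r → ℝ) (u : Fin r → Fin m → ℝ) (v : Fin r → Fin n → ℝ)
    (hr : A.rank = r)
    (hσpos : ∀ i, 0 < σ i)
    (hσanti : ∀ i j : Fin r, i ≤ j → σ j ≤ σ i)
    (hu : ∀ i j : Fin r, (∑ x, u i x * u j x) = if i = j then (1 : ℝ) else 0)
    (hv : ∀ i j : Fin r, (∑ x, v i x * v j x) = if i = j then (1 : ℝ) else 0)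
    (hsvd : γ • (A * P) = ∑ i : Fin r, σ i • vecMulVec (u i) (v i))
    (j : Fin r)
    (Atil : Matrix (Fin m) (Fin n) ℝ)
    (hAtil : Atil = γ⁻¹ • ((∑ i ∈ Finset.univ.filter (fun i : Fin r => i ≠ j),
        σ i • vecMulVec (u i) (v i)) * Pᵀ)) :
    frob ((A - Atil) * X) = (σ j / γ) * Real.sqrt (∑ a, d a * (v j a) ^ 2) := by
  have hPP : P * Pᵀ = 1 := mul_eq_one_comm.mp hP
  have hA : A = γ⁻¹ • ((∑ i, σ i • vecMulVec (u i) (v i)) * Pᵀ) := by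
    rw [← hsvd, Matrix.smul_mul, smul_smul, inv_mul_cancel₀ hγ.ne', one_smul, Matrix.mul_assoc,
      hPP, Matrix.mul_one]
  have hdiff : (A - Atil) * X = (σ j / γ) • vecMulVec (u j) (v j ᵥ* (Pᵀ * X)) := by
    rw [hAtil, hA, ← smul_sub, ← Matrix.sub_mul, Finset.filter_ne',
      ← Finset.add_sum_erase _ _ (Finset.mem_univ j), add_sub_cancel_right, Matrix.smul_mul,
      Matrix.mul_assoc, Matrix.smul_mul, smul_smul, vecMulVec_mul, div_eq_inv_mul]
  have huj : u j ⬝ᵥ u j = 1 := by simpa [dotProduct] using hu j j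
  rw [hdiff, frob_smul_vecMulVec _ (div_pos (hσpos j) hγ).le _ _ huj,
    dotProduct_vecMul_of_spectral hP hspec]
  congr 2
  simp only [dotProduct, mulVec_diagonal]
  exact Finset.sum_congr rfl fun a _ => by ring
end

section
/- Let A ∈ ℝ^{m×n}, let X ∈ ℝ^{n×p} have full row rank n, let X Xᵀ = P Λ Pᵀ be a spectral decomposition with P orthogonal and Λ diagonal with positive diagonal entries, and let γ > 0 satisfy γ² ≥ λ_max, where λ_max is the largest diagonal entry of Λ. Let γ·(A P) = Σ_{i=1}^r σ̂_i û_i v̂_iᵀ be an SVD with r = rank(A), and for 1 ≤ k ≤ r define Ã_k = (1/γ)·(Σ_{i=1}^k σ̂_i û_i v̂_iᵀ)·Pᵀ. Then the squared compression loss is bounded by the sum of the squares of the truncated singular values: ‖(A − Ã_k) X‖_F² ≤ Σ_{i=k+1}^r σ̂_i². -/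
open Matrix Finset

theorem frob_sq_eq_trace {m n : ℕ} (M : Matrix (Fin m) (Fin n) ℝ) :
    frob M ^ 2 = (M * Mᵀ).trace := by
  rw [frob, Real.sq_sqrt (by positivity)]
  simp [Matrix.trace, Matrix.mul_apply, sq]

theorem trace_mul_diagonal_mul_transpose_le {m n : ℕ} (T : Matrix (Fin m) (Fin n) ℝ)
    {d : Fin n → ℝ} {c : ℝ} (hd : ∀ a, d a ≤ c) :
    (T * diagonal d * Tᵀ).trace ≤ c * (T * Tᵀ).trace := by
  simp only [Matrix.trace, Matrix.diag_apply, Matrix.mul_apply (N := Tᵀ), Matrix.mul_diagonal,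
    Matrix.transpose_apply, Finset.mul_sum]
  refine Finset.sum_le_sum fun i _ => Finset.sum_le_sum fun j _ => ?_
  linarith [mul_le_mul_of_nonneg_right (hd j) (mul_self_nonneg (T i j))]

theorem trace_sum_smul_vecMulVec_mul_transpose {m n r : ℕ} (s : Finset (Fin r)) (σ : Fin r → ℝ)
    (u : Fin r → Fin m → ℝ) (v : Fin r → Fin n → ℝ)
    (hu : ∀ i j : Fin r, (∑ x, u i x * u j x) = if i = j then (1 : ℝ) else 0)
    (hv : ∀ i j : Fin r, (∑ x, v i x * v j x) = if i = j then (1 : ℝ) else 0) :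
    ((∑ i ∈ s, σ i • vecMulVec (u i) (v i)) * (∑ i ∈ s, σ i • vecMulVec (u i) (v i))ᵀ).trace =
      ∑ i ∈ s, σ i ^ 2 := by
  have hu' : ∀ i j, u i ⬝ᵥ u j = if i = j then (1 : ℝ) else 0 := hu
  have hv' : ∀ i j, v i ⬝ᵥ v j = if i = j then (1 : ℝ) else 0 := hv
  simp only [Matrix.transpose_sum, Matrix.transpose_smul, Matrix.transpose_vecMulVec,
    Matrix.sum_mul, Matrix.mul_sum, Matrix.trace_sum, Matrix.smul_mul, Matrix.mul_smul,
    Matrix.trace_smul, Matrix.vecMulVec_mul_vecMulVec, Matrix.vecMulVec_smul,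
    Matrix.trace_vecMulVec, hu', hv', smul_eq_mul]
  refine Finset.sum_congr rfl fun i hi => ?_
  simp [hi, sq]

/-- ASVD-III upper bound: if `γ² ≥ λ_max` (i.e. `γ²` dominates every diagonal entry of `Λ`),
then the squared compression loss of the rank-`k` truncation of the SVD of `γ·(A P)` is bounded
by the sum of the squares of the truncated singular values. -/
theorem asvd_scaled_eigen_truncation_sq_loss_le
    (m n p r k : ℕ) (A : Matrix (Fin m) (Fin n) ℝ)
    (X : Matrix (Fin n) (Fin p) ℝ) (hX : X.rank = n)
    (P : Matrix (Fin n) (Fin n) ℝ) (d : Fin n → ℝ)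
    (hP : Pᵀ * P = 1) (hd : ∀ i, 0 < d i)
    (hspec : X * Xᵀ = P * Matrix.diagonal d * Pᵀ)
    (γ : ℝ) (hγ : 0 < γ) (hγmax : ∀ a, d a ≤ γ ^ 2)
    (σ : Fin r → ℝ) (u : Fin r → Fin m → ℝ) (v : Fin r → Fin n → ℝ)
    (hr : A.rank = r)
    (hσpos : ∀ i, 0 < σ i)
    (hσanti : ∀ i j : Fin r, i ≤ j → σ j ≤ σ i)
    (hu : ∀ i j : Fin r, (∑ x, u i x * u j x) = if i = j then (1 : ℝ) else 0)
    (hv : ∀ i j : Fin r, (∑ x, v i x * v j x) = if i = j then (1 : ℝ) else 0)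
    (hsvd : γ • (A * P) = ∑ i : Fin r, σ i • vecMulVec (u i) (v i))
    (hk1 : 1 ≤ k) (hkr : k ≤ r)
    (Ak : Matrix (Fin m) (Fin n) ℝ)
    (hAk : Ak = γ⁻¹ • ((∑ i ∈ Finset.univ.filter (fun i : Fin r => (i : ℕ) < k),
        σ i • vecMulVec (u i) (v i)) * Pᵀ)) :
    frob ((A - Ak) * X) ^ 2 ≤
      ∑ i ∈ Finset.univ.filter (fun i : Fin r => k ≤ (i : ℕ)), σ i ^ 2 := by
  have hPP : P * Pᵀ = 1 := mul_eq_one_comm.mp hP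
  set T := ∑ i ∈ Finset.univ.filter (fun i : Fin r => k ≤ (i : ℕ)), σ i • vecMulVec (u i) (v i)
    with hT
  have hsplit : γ • (A * P) = (∑ i ∈ Finset.univ.filter (fun i : Fin r => (i : ℕ) < k),
      σ i • vecMulVec (u i) (v i)) + T := by
    rw [hsvd, hT, ← Finset.sum_filter_add_sum_filter_not _ (fun i : Fin r => (i : ℕ) < k)]
    simp only [not_lt]
  have hA : A = γ⁻¹ • ((γ • (A * P)) * Pᵀ) := by
    rw [Matrix.smul_mul, smul_smul, inv_mul_cancel₀ hγ.ne', one_smul, Matrix.mul_assoc, hPP,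
      Matrix.mul_one]
  have hdiff : A - Ak = γ⁻¹ • (T * Pᵀ) := by
    rw [hA, hsplit, hAk, Matrix.add_mul, smul_add, add_sub_cancel_left]
  have hgram : (A - Ak) * X * ((A - Ak) * X)ᵀ = (γ ^ 2)⁻¹ • (T * diagonal d * Tᵀ) := by
    calc (A - Ak) * X * ((A - Ak) * X)ᵀ
        = (A - Ak) * (X * Xᵀ) * (A - Ak)ᵀ := by
          simp only [Matrix.transpose_mul, Matrix.mul_assoc]
      _ = (γ⁻¹ * γ⁻¹) • (T * (Pᵀ * P) * diagonal d * (Pᵀ * P) * Tᵀ) := by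
          rw [hdiff, hspec]
          simp only [Matrix.transpose_smul, Matrix.transpose_mul, Matrix.transpose_transpose,
            Matrix.smul_mul, Matrix.mul_smul, smul_smul, Matrix.mul_assoc]
      _ = (γ ^ 2)⁻¹ • (T * diagonal d * Tᵀ) := by
          rw [hP, Matrix.mul_one, Matrix.mul_one, sq, mul_inv]
  rw [frob_sq_eq_trace, hgram, Matrix.trace_smul, smul_eq_mul,
    ← trace_sum_smul_vecMulVec_mul_transpose _ σ u v hu hv, inv_mul_le_iff₀ (by positivity)]
  exact trace_mul_diagonal_mul_transpose_le T hγmax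
end
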